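/- In the normal game on the 1×n board with target string SOS = [S,O,S]: the first player can force a win if and only if n ≥ 7 and n is odd; the second player can force a win if and only if n ≥ 16 and n is even; in all other cases the game is a draw (neither player can force a win). -/

import Mathlib

/-- The two letters of the SOS game. -/
inductive Letter : Type
  | S : Letter
  | O : Letter
  deriving DecidableEq

open Letter

/-- The target string `t` occurs left-to-right as a consecutive block on the
linear board `b`. -/
def Achieves {n : ℕ} (t : List Letter) (b : Fin n → Option Letter) : Prop :=
  ∃ i : ℕ, ∀ j : ℕ, (hj : j < t.length) → ∃ h : i + j < n,
    b ⟨i + j, h⟩ = some (t.get ⟨j, hj⟩)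

/-- `Force Win m w b`: the player to move in position `b` (with `m` remaining moves,
i.e. `m` empty cells) can force a win when `w = true`, resp. can force at least a
draw when `w = false`, in the normal game whose winning boards are given by `Win`
(a player wins if the board satisfies `Win` immediately after their move). -/
def Force {α : Type} [DecidableEq α] (Win : (α → Option Letter) → Prop) :
    ℕ → Bool → (α → Option Letter) → Prop
  | 0, w, _ => w = false
  | m + 1, w, b => ∃ i : α, ∃ x : Letter, b i = none ∧
      (Win (Function.update b i (some x)) ∨
        ¬ Force Win m (!w) (Function.update b i (some x)))

/-- The first player can force a win in the normal game with target `t`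
on the (initially empty) 1×n board. -/
def FirstWins (t : List Letter) (n : ℕ) : Prop :=
  Force (Achieves t) n true (fun _ : Fin n => none)

/-- The second player can force a win in the normal game with target `t`
on the (initially empty) 1×n board: the first player (to move) cannot even
force a draw. -/
def SecondWins (t : List Letter) (n : ℕ) : Prop :=
  ¬ Force (Achieves t) n false (fun _ : Fin n => none)

/-- The normal game with target `t` on the 1×n board is a draw under optimal
play: the first player can force at least a draw, and the second player can
force at least a draw (i.e. the first player cannot force a win). -/
def IsDraw (t : List Letter) (n : ℕ) : Prop :=
  Force (Achieves t) n false (fun _ : Fin n => none) ∧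
    ¬ Force (Achieves t) n true (fun _ : Fin n => none)


namespace SOSGame

/-- Cell contents extended to all integers; `none` means outside of the board. -/
def cell {n : ℕ} (b : Fin n → Option Letter) (k : ℤ) : Option (Option Letter) :=
  if h : 0 ≤ k ∧ k < n then some (b ⟨k.toNat, by omega⟩) else none

/-- Placing a letter on an extended board. -/
def upd (c : ℤ → Option (Option Letter)) (i : ℤ) (x : Letter) : ℤ → Option (Option Letter) :=
  fun k => if k = i then some (some x) else c k

/-- A completed SOS. -/
def W (c : ℤ → Option (Option Letter)) : Prop :=
  ∃ k : ℤ, c k = some (some S) ∧ c (k+1) = some (some O) ∧ c (k+2) = some (some S)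

/-- A threat located at `k`. -/
def TH (c : ℤ → Option (Option Letter)) (k : ℤ) : Prop :=
  (c k = some (some S) ∧ c (k+1) = some (some O) ∧ c (k+2) = some none) ∨
  (c k = some (some S) ∧ c (k+1) = some none ∧ c (k+2) = some (some S)) ∨
  (c k = some none ∧ c (k+1) = some (some O) ∧ c (k+2) = some (some S))

/-- There is a threat. -/
def T (c : ℤ → Option (Option Letter)) : Prop := ∃ k, TH c k

/-- The pattern `S _ _ S` at `k`. -/
def SSat (c : ℤ → Option (Option Letter)) (k : ℤ) : Prop :=
  c k = some (some S) ∧ c (k+1) = some none ∧ c (k+2) = some none ∧ c (k+3) = some (some S)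

/-- The pattern `S _ _ S` occurs. -/
def SS (c : ℤ → Option (Option Letter)) : Prop := ∃ k, SSat c k

/-- The pattern `S _ _ S` can never appear any more. -/
def Dead (c : ℤ → Option (Option Letter)) : Prop :=
  ∀ k, ¬ ((c k = some (some S) ∨ c k = some none) ∧ c (k+1) = some none ∧ c (k+2) = some none ∧
    (c (k+3) = some (some S) ∨ c (k+3) = some none))

theorem cell_update {n : ℕ} (b : Fin n → Option Letter) (i : Fin n) (x : Letter) :
    cell (Function.update b i (some x)) = upd (cell b) (i : ℕ) x := by
  funext k
  unfold cell upd
  by_cases h : 0 ≤ k ∧ k < n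
  · simp only [h, and_self, dite_true]
    by_cases hk : k = (i : ℕ)
    · subst hk; simp
    · simp only [hk, if_false]
      rw [Function.update_of_ne]
      intro h'
      apply hk
      have := congrArg Fin.val h'
      simp at this
      omega
  · have : k ≠ (i : ℕ) := by have := i.2; omega
    simp [h, this]

theorem cell_fin {n : ℕ} (b : Fin n → Option Letter) (i : Fin n) : cell b (i : ℕ) = some (b i) := by
  simp [cell]

theorem cell_some {n : ℕ} {b : Fin n → Option Letter} {k : ℤ} {x} (h : cell b k = some x) :
    ∃ i : Fin n, ((i : ℕ) : ℤ) = k ∧ b i = x := by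
  unfold cell at h
  split_ifs at h with hk
  exact ⟨⟨k.toNat, by omega⟩, by simp [hk.1], by simpa using h⟩

theorem achieves_iff {n : ℕ} (b : Fin n → Option Letter) :
    Achieves [S, O, S] b ↔ W (cell b) := by
  constructor
  · rintro ⟨i, hi⟩
    obtain ⟨h0, e0⟩ := hi 0 (by simp)
    obtain ⟨h1, e1⟩ := hi 1 (by simp)
    obtain ⟨h2, e2⟩ := hi 2 (by simp)
    refine ⟨i, ?_, ?_, ?_⟩
    · have := cell_fin b ⟨i+0, h0⟩
      rw [e0] at this; simpa using this
    · have := cell_fin b ⟨i+1, h1⟩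
      rw [e1] at this; simpa using this
    · have := cell_fin b ⟨i+2, h2⟩
      rw [e2] at this; simpa using this
  · rintro ⟨k, h0, h1, h2⟩
    obtain ⟨i0, a0, b0⟩ := cell_some h0
    obtain ⟨i1, a1, b1⟩ := cell_some h1
    obtain ⟨i2, a2, b2⟩ := cell_some h2
    have p1 : i1 = ⟨i0 + 1, by omega⟩ := Fin.ext (by simp; omega)
    have p2 : i2 = ⟨i0 + 2, by omega⟩ := Fin.ext (by simp; omega)
    rw [p1] at b1
    rw [p2] at b2
    refine ⟨i0, fun j hj => ?_⟩
    simp at hj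
    interval_cases j
    · exact ⟨by omega, by simpa using b0⟩
    · exact ⟨by omega, by simpa using b1⟩
    · exact ⟨by omega, by simpa using b2⟩

/-- The number of empty cells. -/
def emp {n : ℕ} (b : Fin n → Option Letter) : ℕ := (Finset.univ.filter (fun i => b i = none)).card

theorem emp_update {n : ℕ} (b : Fin n → Option Letter) (i : Fin n) (x : Letter) (hi : b i = none) (m : ℕ)
    (hm : emp b = m + 1) : emp (Function.update b i (some x)) = m := by
  unfold emp at *
  have : (Finset.univ.filter (fun j => Function.update b i (some x) j = none)) =
      (Finset.univ.filter (fun j => b j = none)).erase i := by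
    ext j
    by_cases h : j = i
    · subst h; simp
    · simp [h]
  rw [this, Finset.card_erase_of_mem (by simp [hi]), hm]; rfl

theorem exists_empty {n : ℕ} (b : Fin n → Option Letter) (m : ℕ) (hm : emp b = m + 1) : ∃ i, b i = none := by
  unfold emp at hm
  have : 0 < (Finset.univ.filter (fun j => b j = none)).card := by omega
  obtain ⟨i, hi⟩ := Finset.card_pos.1 this
  exact ⟨i, by simpa using hi⟩

/-! Local combinatorics of extended boards. -/

theorem win_of_T {c} (h : T c) : ∃ i x, c i = some none ∧ W (upd c i x) := by
  obtain ⟨k, h | h | h⟩ := h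
  · refine ⟨k+2, S, h.2.2, k, ?_⟩
    simp [upd, h]
  · refine ⟨k+1, O, h.2.1, k, ?_⟩
    simp [upd, h]
  · refine ⟨k, S, h.1, k, ?_⟩
    simp [upd, h]

theorem not_win {c} (hW : ¬ W c) (hT : ¬ T c) {i x} (hi : c i = some none) : ¬ W (upd c i x) := by
  rintro ⟨k, h0, h1, h2⟩
  have hT' : ¬ TH c k := fun h => hT ⟨k, h⟩
  have hW' : ¬ (c k = some (some S) ∧ c (k+1) = some (some O) ∧ c (k+2) = some (some S)) :=
    fun h => hW ⟨k, h⟩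
  unfold upd at h0 h1 h2
  unfold TH at hT'
  grind

theorem loc_S {c} (hT : ¬ T c) {i} (hi : c i = some none) (h : T (upd c i S)) :
    (c (i+1) = some (some O) ∧ c (i+2) = some none) ∨ (c (i+1) = some none ∧ c (i+2) = some (some S)) ∨
    (c (i-1) = some (some O) ∧ c (i-2) = some none) ∨ (c (i-1) = some none ∧ c (i-2) = some (some S)) := by
  obtain ⟨k, h⟩ := h
  have hT' : ¬ TH c k := fun h => hT ⟨k, h⟩
  unfold TH at hT' h
  unfold upd at h
  by_cases h0 : k = i
  · subst h0; grind
  by_cases h1 : k + 1 = i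
  · subst h1; grind
  by_cases h2 : k + 2 = i
  · subst h2
    have e1 : k + 2 - 1 = k + 1 := by ring
    have e2 : k + 2 - 2 = k := by ring
    rw [e1, e2]
    grind
  simp only [h0, h1, h2, if_false] at h
  exact absurd h hT'

theorem loc_O {c} (hT : ¬ T c) {i} (hi : c i = some none) (h : T (upd c i O)) :
    (c (i-1) = some (some S) ∧ c (i+1) = some none) ∨ (c (i-1) = some none ∧ c (i+1) = some (some S)) := by
  obtain ⟨k, h⟩ := h
  have hT' : ¬ TH c k := fun h => hT ⟨k, h⟩
  unfold TH at hT' h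
  unfold upd at h
  by_cases h0 : k = i
  · subst h0; grind
  by_cases h1 : k + 1 = i
  · subst h1
    have e1 : k + 1 - 1 = k := by ring
    have e2 : k + 1 + 1 = k + 2 := by ring
    rw [e1, e2]
    grind
  by_cases h2 : k + 2 = i
  · subst h2; grind
  simp only [h0, h1, h2, if_false] at h
  exact absurd h hT'

theorem bad {c} (hT : ¬ T c) {i} (hi : c i = some none) (h : ∀ x, T (upd c i x)) :
    SSat c (i-1) ∨ SSat c (i-2) := by
  have h1 := loc_S hT hi (h S)
  have h2 := loc_O hT hi (h O)
  unfold SSat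
  have e1 : i - 1 + 1 = i := by ring
  have e2 : i - 1 + 2 = i + 1 := by ring
  have e3 : i - 1 + 3 = i + 2 := by ring
  have e4 : i - 2 + 1 = i - 1 := by ring
  have e5 : i - 2 + 2 = i := by ring
  have e6 : i - 2 + 3 = i + 1 := by ring
  rw [e1, e2, e3, e4, e5, e6]
  grind

theorem SS_upd {c} (h : SS c) (i x) (hi : c i = some none) : SS (upd c i x) ∨ T (upd c i x) := by
  obtain ⟨k, h⟩ := h
  unfold SSat at h
  obtain ⟨h0, h1, h2, h3⟩ := h
  by_cases a1 : i = k + 1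
  · subst a1
    right
    cases x
    · refine ⟨k+1, ?_⟩
      unfold TH upd
      grind
    · refine ⟨k, ?_⟩
      unfold TH upd
      grind
  by_cases a2 : i = k + 2
  · subst a2
    right
    cases x
    · refine ⟨k, ?_⟩
      unfold TH upd
      grind
    · refine ⟨k+1, ?_⟩
      unfold TH upd
      grind
  left
  refine ⟨k, ?_⟩
  unfold SSat upd
  grind

theorem Dead_upd {c} (h : Dead c) (i x) (hi : c i = some none) : Dead (upd c i x) := by
  intro k hk
  have := h k
  unfold upd at hk
  grind

theorem exists_good {n : ℕ} (b : Fin n → Option Letter) (hT : ¬ T (cell b)) (ho : Odd (emp b)) :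
    ∃ i x, b i = none ∧ ¬ T (upd (cell b) (i : ℕ) x) := by
  by_contra! hcon
  have hbad : ∀ i, b i = none → SSat (cell b) ((i : ℕ) - 1 : ℤ) ∨ SSat (cell b) ((i : ℕ) - 2 : ℤ) :=
    fun i hi => bad hT (by rw [cell_fin, hi]) (fun x => hcon i x hi)
  classical
  let L := Finset.univ.filter (fun i : Fin n => SSat (cell b) ((i : ℕ) - 1 : ℤ))
  let R := Finset.univ.filter (fun i : Fin n => SSat (cell b) ((i : ℕ) - 2 : ℤ))
  have hE : Finset.univ.filter (fun i => b i = none) = L ∪ R := by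
    ext i
    simp only [L, R, Finset.mem_filter, Finset.mem_univ, true_and, Finset.mem_union]
    refine ⟨hbad i, ?_⟩
    have := cell_fin b i
    rintro (h | h)
    · have h := h.2.1
      rw [show ((i : ℕ) - 1 : ℤ) + 1 = (i : ℕ) by ring] at h
      rw [this] at h; simpa using h
    · have h := h.2.2.1
      rw [show ((i : ℕ) - 2 : ℤ) + 2 = (i : ℕ) by ring] at h
      rw [this] at h; simpa using h
  have hd : Disjoint L R := by
    rw [Finset.disjoint_left]
    intro i h1 h2
    simp only [L, R, Finset.mem_filter, Finset.mem_univ, true_and] at h1 h2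
    have h1 := h1.1
    have h2 := h2.2.1
    rw [show ((i : ℕ) - 2 : ℤ) + 1 = (i : ℕ) - 1 by ring, h1] at h2
    simp at h2
  have hc : L.card = R.card := by
    apply le_antisymm
    · refine Finset.card_le_card_of_injOn
        (fun i => if h : (i : ℕ) + 1 < n then ⟨i + 1, h⟩ else i) ?_ ?_
      · intro i hi
        simp only [L, R, Finset.coe_filter, Finset.mem_univ, true_and, Set.mem_ofPred_eq] at hi ⊢
        obtain ⟨j, hj, _⟩ := cell_some hi.2.2.1
        have : (i : ℕ) + 1 < n := by have := j.2; omega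
        simp only [this, dite_true]
        convert hi using 1
        push_cast; ring
      · intro i hi j hj hij
        simp only [L, Finset.coe_filter, Finset.mem_univ, true_and, Set.mem_ofPred_eq] at hi hj
        obtain ⟨j1, hj1, _⟩ := cell_some hi.2.2.1
        obtain ⟨j2, hj2, _⟩ := cell_some hj.2.2.1
        have a : (i : ℕ) + 1 < n := by have := j1.2; omega
        have a' : (j : ℕ) + 1 < n := by have := j2.2; omega
        simp only [a, a', dite_true, Fin.mk.injEq] at hij
        exact Fin.ext (by omega)
    · refine Finset.card_le_card_of_injOn
        (fun i => ⟨(i : ℕ) - 1, by have := i.2; omega⟩) ?_ ?_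
      · intro i hi
        simp only [L, R, Finset.coe_filter, Finset.mem_univ, true_and, Set.mem_ofPred_eq] at hi ⊢
        obtain ⟨j, hj, _⟩ := cell_some hi.2.1
        convert hi using 1
        omega
      · intro i hi j hj hij
        simp only [R, Finset.coe_filter, Finset.mem_univ, true_and, Set.mem_ofPred_eq] at hi hj
        obtain ⟨j1, hj1, _⟩ := cell_some hi.2.1
        obtain ⟨j2, hj2, _⟩ := cell_some hj.2.1
        simp only [Fin.mk.injEq] at hij
        exact Fin.ext (by omega)
  unfold emp at ho
  rw [hE, Finset.card_union_of_disjoint hd, hc] at ho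
  exact (Nat.not_odd_iff_even.2 ⟨_, rfl⟩) ho

theorem force_of_T {n : ℕ} (b : Fin n → Option Letter) (m : ℕ) (w : Bool) (h : T (cell b)) :
    Force (Achieves [S, O, S]) (m+1) w b := by
  obtain ⟨i, x, hi, hw⟩ := win_of_T h
  obtain ⟨j, hj, hb⟩ := cell_some hi
  refine ⟨j, x, hb, Or.inl ?_⟩
  rw [achieves_iff, cell_update, hj]
  exact hw

theorem force_of_move {n : ℕ} (b : Fin n → Option Letter) (m : ℕ) (w : Bool) (i : Fin n) (x : Letter)
    (hi : b i = none) (h : ¬ Force (Achieves [S, O, S]) m (!w) (Function.update b i (some x))) :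
    Force (Achieves [S, O, S]) (m+1) w b := ⟨i, x, hi, Or.inr h⟩

theorem not_force {n : ℕ} (b : Fin n → Option Letter) (m : ℕ) (w : Bool) (hW : ¬ W (cell b))
    (hT : ¬ T (cell b))
    (h : ∀ (i : Fin n) (x : Letter), b i = none → ¬ W (upd (cell b) (i : ℕ) x) →
      Force (Achieves [S, O, S]) m (!w) (Function.update b i (some x))) :
    ¬ Force (Achieves [S, O, S]) (m+1) w b := by
  rintro ⟨i, x, hi, h1 | h1⟩
  · rw [achieves_iff, cell_update] at h1
    exact not_win hW hT (by rw [cell_fin, hi]) h1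
  · exact h1 (h i x hi (not_win hW hT (by rw [cell_fin, hi])))

theorem parity {n : ℕ} (m : ℕ) : ∀ (w : Bool) (b : Fin n → Option Letter), ¬ W (cell b) → emp b = m →
    (Odd m → (w = false ∨ SS (cell b) ∨ T (cell b)) → Force (Achieves [S, O, S]) m w b) ∧
    (Even m → ¬ T (cell b) → (w = false ∨ SS (cell b)) → ¬ Force (Achieves [S, O, S]) m (!w) b) := by
  induction m with
  | zero =>
    intro w b hW hm
    refine ⟨fun h => by simp at h, fun _ hT h => ?_⟩
    rcases h with h | ⟨k, h⟩
    · subst h; simp [Force]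
    · exfalso
      obtain ⟨i, _, hi⟩ := cell_some h.2.1
      unfold emp at hm
      rw [Finset.card_eq_zero] at hm
      have : i ∈ Finset.univ.filter (fun i => b i = none) := by simp [hi]
      rw [hm] at this; simp at this
  | succ m ih =>
    intro w b hW hm
    constructor
    · intro ho h
      by_cases hT : T (cell b)
      · exact force_of_T b m w hT
      obtain ⟨i, x, hi, hg⟩ := exists_good b hT (hm ▸ ho)
      have hci : cell b (i : ℕ) = some none := by rw [cell_fin, hi]
      refine force_of_move b m w i x hi ?_
      refine (ih w _ ?_ (emp_update b i x hi m hm)).2 (by grind) ?_ ?_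
      · rw [cell_update]; exact not_win hW hT hci
      · rw [cell_update]; exact hg
      · rw [cell_update]
        rcases h with h | h | h
        · exact Or.inl h
        · exact Or.inr ((SS_upd h i x hci).resolve_right hg)
        · exact absurd h hT
    · intro he hT h
      refine not_force b m _ hW hT ?_
      intro i x hi hW'
      have hci : cell b (i : ℕ) = some none := by rw [cell_fin, hi]
      rw [Bool.not_not]
      refine (ih w _ (by rw [cell_update]; exact hW') (emp_update b i x hi m hm)).1 (by grind) ?_
      rw [cell_update]
      rcases h with h | h
      · exact Or.inl h
      · exact Or.inr (SS_upd h i x hci)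

theorem dead_draw {n : ℕ} (m : ℕ) : ∀ (b : Fin n → Option Letter), ¬ W (cell b) → emp b = m →
    Dead (cell b) → Force (Achieves [S, O, S]) m false b ∧
      (¬ T (cell b) → ¬ Force (Achieves [S, O, S]) m true b) := by
  induction m with
  | zero => intro b _ _ _; simp [Force]
  | succ m ih =>
    intro b hW hm hD
    constructor
    · by_cases hT : T (cell b)
      · exact force_of_T b m _ hT
      obtain ⟨i, hi⟩ := exists_empty b m hm
      have hci : cell b (i : ℕ) = some none := by rw [cell_fin, hi]
      by_cases hx : ∀ x, T (upd (cell b) (i : ℕ) x)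
      · rcases bad hT hci hx with h | h
        · exact absurd ⟨Or.inl h.1, h.2.1, h.2.2.1, Or.inl h.2.2.2⟩ (hD _)
        · exact absurd ⟨Or.inl h.1, h.2.1, h.2.2.1, Or.inl h.2.2.2⟩ (hD _)
      · push Not at hx
        obtain ⟨x, hx⟩ := hx
        refine force_of_move b m _ i x hi ?_
        refine (ih _ ?_ (emp_update b i x hi m hm) ?_).2 ?_ <;> rw [cell_update]
        · exact not_win hW hT hci
        · exact Dead_upd hD _ _ hci
        · exact hx
    · intro hT
      refine not_force b m _ hW hT ?_
      intro i x hi hW'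
      refine (ih _ ?_ (emp_update b i x hi m hm) ?_).1 <;> rw [cell_update]
      · exact hW'
      · exact Dead_upd hD _ _ (by rw [cell_fin, hi])

/-- No threat arises from putting `S` next to the cells `x`, `y` (in this order). -/
def safe (x y : Option (Option Letter)) : Prop :=
  ¬ (x = some (some O) ∧ y = some none) ∧ ¬ (x = some none ∧ y = some (some S))

theorem make_SS {n : ℕ} (m : ℕ) (b : Fin n → Option Letter) (hW : ¬ W (cell b)) (hm : emp b = m + 1)
    (he : Even m) (hT : ¬ T (cell b)) (q : ℤ) (hq : cell b q = some none)
    (h1 : safe (cell b (q+1)) (cell b (q+2))) (h2 : safe (cell b (q-1)) (cell b (q-2)))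
    (h : SS (upd (cell b) q S)) :
    Force (Achieves [S, O, S]) (m+1) true b := by
  obtain ⟨i, rfl, hi⟩ := cell_some hq
  refine force_of_move b m _ i S hi ?_
  refine (parity m true _ ?_ (emp_update b i S hi m hm)).2 he ?_ (Or.inr ?_) <;> rw [cell_update]
  · exact not_win hW hT hq
  · intro hT'
    have := loc_S hT hq hT'
    unfold safe at h1 h2
    tauto
  · exact h

theorem fork {n : ℕ} (m : ℕ) (b : Fin n → Option Letter) (hW : ¬ W (cell b)) (hm : emp b = m + 2)
    (he : Even m) (hT : ¬ T (cell b)) (p : ℤ) (hp : cell b p = some (some S))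
    (r1 : cell b (p+1) = some none) (r2 : cell b (p+2) = some none) (r3 : cell b (p+3) = some none)
    (l1 : cell b (p-1) = some none) (l2 : cell b (p-2) = some none) (l3 : cell b (p-3) = some none)
    (hr : safe (cell b (p+4)) (cell b (p+5))) (hl : safe (cell b (p-4)) (cell b (p-5))) :
    ¬ Force (Achieves [S, O, S]) (m+2) false b := by
  refine not_force b (m+1) _ hW hT ?_
  intro i x hi hW'
  have hci : cell b (i : ℕ) = some none := by rw [cell_fin, hi]
  by_cases hT' : T (upd (cell b) (i : ℕ) x)
  · exact force_of_T _ _ _ (by rw [cell_update]; exact hT')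
  generalize hz : ((i : ℕ) : ℤ) = z at *
  have hcell : cell (Function.update b i (some x)) = upd (cell b) z x := by rw [cell_update, hz]
  have hem := emp_update b i x hi (m+1) hm
  have hzp : z ≠ p := by rintro rfl; rw [hp] at hci; simp at hci
  rcases lt_or_gt_of_ne hzp with hlt | hlt
  · have hne : ∀ q, p ≤ q → upd (cell b) z x q = cell b q := by
      intro q hq; unfold upd; rw [if_neg (by omega)]
    refine make_SS m _ (by rw [hcell]; exact hW') hem he (by rw [hcell]; exact hT') (p+3) ?_ ?_ ?_
      ⟨p, ?_⟩ <;> rw [hcell]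
    · rw [hne _ (by omega), r3]
    · rw [hne _ (by omega), hne _ (by omega), add_assoc, add_assoc]; exact hr
    · rw [hne _ (by omega), hne _ (by omega), show p + 3 - 1 = p + 2 by ring,
        show p + 3 - 2 = p + 1 by ring, r1, r2]; simp [safe]
    · have a0 := hne p (by omega)
      have a1 := hne (p+1) (by omega)
      have a2 := hne (p+2) (by omega)
      generalize upd (cell b) z x = c at *
      simp [SSat, upd, a0, a1, a2, hp, r1, r2]
  · have hne : ∀ q, q ≤ p → upd (cell b) z x q = cell b q := by
      intro q hq; unfold upd; rw [if_neg (by omega)]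
    refine make_SS m _ (by rw [hcell]; exact hW') hem he (by rw [hcell]; exact hT') (p-3) ?_ ?_ ?_
      ⟨p-3, ?_⟩ <;> rw [hcell]
    · rw [hne _ (by omega), l3]
    · rw [hne _ (by omega), hne _ (by omega), show p - 3 + 1 = p - 2 by ring,
        show p - 3 + 2 = p - 1 by ring, l1, l2]; simp [safe]
    · rw [hne _ (by omega), hne _ (by omega), show p - 3 - 1 = p - 4 by ring,
        show p - 3 - 2 = p - 5 by ring]; exact hl
    · have a0 := hne p (by omega)
      have a1 := hne (p-1) (by omega)
      have a2 := hne (p-2) (by omega)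
      generalize upd (cell b) z x = c at *
      unfold SSat
      rw [show p - 3 + 1 = p - 2 by ring, show p - 3 + 2 = p - 1 by ring,
        show p - 3 + 3 = p by ring]
      simp [upd, a0, a1, a2, hp, l1, l2]

/-- The initial board. -/
abbrev ini (n : ℕ) : Fin n → Option Letter := fun _ => none

theorem cell_ini (n : ℕ) (k : ℤ) : cell (ini n) k = if 0 ≤ k ∧ k < n then some none else none := by
  unfold cell; split_ifs <;> rfl

theorem emp_ini (n : ℕ) : emp (ini n) = n := by simp [emp]

theorem W_ini (n : ℕ) : ¬ W (cell (ini n)) := by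
  rintro ⟨k, h, _⟩
  rw [cell_ini] at h
  split_ifs at h <;> simp at h

theorem T_ini (n : ℕ) : ¬ T (cell (ini n)) := by
  rintro ⟨k, h⟩
  unfold TH at h
  simp only [cell_ini] at h
  grind

theorem T_one (n : ℕ) (i x) : ¬ T (upd (cell (ini n)) i x) := by
  rintro ⟨k, h⟩
  unfold TH upd at h
  simp only [cell_ini] at h
  grind

theorem T_two (n : ℕ) (i j : ℤ) (x y) (h : i + 2 < j ∨ j + 2 < i) :
    ¬ T (upd (upd (cell (ini n)) i x) j y) := by
  rintro ⟨k, h⟩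
  unfold TH upd at h
  simp only [cell_ini] at h
  grind

theorem first_wins (n : ℕ) (h7 : 7 ≤ n) (ho : Odd n) : FirstWins [S, O, S] n := by
  obtain ⟨m, rfl⟩ : ∃ m, n = (m + 2) + 1 := ⟨n - 3, by omega⟩
  have hW := W_ini (m+2+1)
  have hT := T_ini (m+2+1)
  have hem := emp_ini (m+2+1)
  refine force_of_move (ini (m+2+1)) _ _ (⟨3, by omega⟩ : Fin (m+2+1)) S rfl ?_
  have hc : cell (Function.update (ini (m+2+1)) (⟨3, by omega⟩ : Fin (m+2+1)) (some S)) =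
    upd (cell (ini (m+2+1))) 3 S := by rw [cell_update]; rfl
  refine fork m _ ?_ (emp_update _ _ _ rfl _ hem) (by grind) ?_ 3 ?_ ?_ ?_ ?_ ?_ ?_ ?_ ?_ ?_ <;> rw [hc]
  · exact not_win (i := 3) hW hT (by rw [cell_ini, if_pos ⟨by norm_num, by push_cast; omega⟩])
  · exact T_one _ _ _
  all_goals simp only [upd, cell_ini, safe]; push_cast
  · simp
  · grind
  · grind
  · grind
  · grind
  · grind
  · grind
  · grind
  · grind

theorem second_wins (n : ℕ) (h7 : 16 ≤ n) (ho : Even n) : SecondWins [S, O, S] n := by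
  obtain ⟨m, rfl⟩ : ∃ m, n = ((m + 2) + 1) + 1 := ⟨n - 4, by omega⟩
  have hW0 := W_ini (m+2+1+1)
  have hT0 := T_ini (m+2+1+1)
  have hem0 := emp_ini (m+2+1+1)
  unfold SecondWins
  refine not_force (ini (m+2+1+1)) _ _ hW0 hT0 ?_
  intro j y hj hW
  have hjn := j.2
  have hem := emp_update _ j y hj _ hem0
  have hT := T_one (m+2+1+1) (j : ℕ) y
  have hc := cell_update (ini (m+2+1+1)) j y
  cases y
  · -- the first player has played `S`
    obtain ⟨q, hq, hq'⟩ : ∃ q : ℤ, (0 ≤ q ∧ q < m+2+1+1) ∧ (q = (j : ℕ) + 3 ∨ q + 3 = (j : ℕ)) := by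
      by_cases h : (j : ℕ) + 3 < m+2+1+1
      · exact ⟨(j : ℕ) + 3, by omega, Or.inl rfl⟩
      · exact ⟨(j : ℕ) - 3, by omega, Or.inr (by omega)⟩
    generalize hz : ((j : ℕ) : ℤ) = z at *
    refine make_SS (m+2) _ (by rw [hc]; exact hW) hem (by grind) (by rw [hc]; exact hT) q ?_ ?_ ?_ ?_ <;> rw [hc]
    · simp only [upd, cell_ini]; push_cast; grind
    · simp only [upd, cell_ini, safe]; push_cast; grind
    · simp only [upd, cell_ini, safe]; push_cast; grind
    · rcases hq' with h | h
      · refine ⟨z, ?_⟩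
        simp only [SSat, upd, cell_ini]; push_cast; grind
      · refine ⟨q, ?_⟩
        simp only [SSat, upd, cell_ini]; push_cast; grind
  · obtain ⟨p, hp⟩ : ∃ p : Fin (m+2+1+1), ((p : ℕ) = j + 5 ∧ (p : ℕ) + 3 < m+2+1+1) ∨ ((p : ℕ) + 5 = j ∧ 3 ≤ (p : ℕ)) := by
      by_cases h : (j : ℕ) + 8 < m+2+1+1
      · exact ⟨⟨j + 5, by omega⟩, Or.inl ⟨rfl, by simp; omega⟩⟩
      · exact ⟨⟨j - 5, by omega⟩, Or.inr ⟨by simp; omega, by simp; omega⟩⟩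
    have hpj : p ≠ j := by rintro rfl; omega
    have hpe : Function.update (ini (m+2+1+1)) j (some O) p = none := by
      rw [Function.update_of_ne hpj]
    have hpn := p.2
    refine force_of_move _ (m+2) _ p S hpe ?_
    have hc2 := cell_update (Function.update (ini (m+2+1+1)) j (some O)) p S
    have hcp := cell_fin (Function.update (ini (m+2+1+1)) j (some O)) p
    rw [hpe, hc] at hcp
    rw [hc] at hc2
    refine fork m _ ?_ (emp_update _ _ _ hpe _ hem) (by grind) ?_ (p : ℕ) ?_ ?_ ?_ ?_ ?_ ?_ ?_ ?_ ?_ <;> rw [hc2]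
    · exact not_win hW hT hcp
    · exact T_two _ _ _ _ _ (by omega)
    all_goals
      generalize hz : ((j : ℕ) : ℤ) = z at *
      generalize hz : ((p : ℕ) : ℤ) = y at *
      simp only [upd, cell_ini, safe]; push_cast
    all_goals grind

/-! A small verified solver on bit masks, for the drawn boards. -/

def thr (s o e : ℕ) : Bool :=
  !((s &&& (o >>> 1) &&& (e >>> 2)) == 0 && (s &&& (e >>> 1) &&& (s >>> 2)) == 0 &&
    (e &&& (o >>> 1) &&& (s >>> 2)) == 0)

def dd (s e : ℕ) : Bool :=
  ((s ||| e) &&& (e >>> 1) &&& (e >>> 2) &&& ((s ||| e) >>> 3)) == 0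

/-- The player who wants to draw moves. -/
def achk (ord : List (ℕ × Bool)) (P : ℕ → ℕ → ℕ → Bool) (s o e : ℕ) : Bool :=
  thr s o e || ord.any fun ix => e.testBit ix.1 &&
    match ix.2 with
    | true => !thr (s ||| 2 ^ ix.1) o (e ^^^ 2 ^ ix.1) && P (s ||| 2 ^ ix.1) o (e ^^^ 2 ^ ix.1)
    | false => !thr s (o ||| 2 ^ ix.1) (e ^^^ 2 ^ ix.1) && P s (o ||| 2 ^ ix.1) (e ^^^ 2 ^ ix.1)

/-- The opponent moves. -/
def pchk (n : ℕ) (ord : List (ℕ × Bool)) : ℕ → ℕ → ℕ → ℕ → Bool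
  | 0, s, _, e => dd s e
  | d + 1, s, o, e => dd s e || (List.range n).all fun i => !e.testBit i ||
      (achk ord (pchk n ord d) (s ||| 2 ^ i) o (e ^^^ 2 ^ i) &&
        achk ord (pchk n ord d) s (o ||| 2 ^ i) (e ^^^ 2 ^ i))

/-- The masks describe the board. -/
def Rel (c : ℤ → Option (Option Letter)) (s o e : ℕ) : Prop :=
  (∀ k : ℤ, k < 0 → c k = none) ∧ ∀ k : ℕ, (c k = some (some S) ↔ s.testBit k = true) ∧
    (c k = some (some O) ↔ o.testBit k = true) ∧ (c k = some none ↔ e.testBit k = true)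

theorem Rel_S {c s o e} (h : Rel c s o e) {i : ℕ} (hi : e.testBit i = true) :
    Rel (upd c i S) (s ||| 2 ^ i) o (e ^^^ 2 ^ i) := by
  refine ⟨fun k hk => ?_, fun k => ?_⟩
  · unfold upd; rw [if_neg (by omega)]; exact h.1 k hk
  · have h1 := h.2 k
    unfold upd
    simp only [Nat.testBit_or, Nat.testBit_xor, Nat.testBit_two_pow, Nat.cast_inj]
    by_cases hk : k = i
    · subst hk
      have : c k = some none := h1.2.2.2 hi
      simp [hi]
      simpa [this] using h1.2.1
    · have : i ≠ k := fun h => hk h.symm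
      simp [hk, this, h1]

theorem Rel_O {c s o e} (h : Rel c s o e) {i : ℕ} (hi : e.testBit i = true) :
    Rel (upd c i O) s (o ||| 2 ^ i) (e ^^^ 2 ^ i) := by
  refine ⟨fun k hk => ?_, fun k => ?_⟩
  · unfold upd; rw [if_neg (by omega)]; exact h.1 k hk
  · have h1 := h.2 k
    unfold upd
    simp only [Nat.testBit_or, Nat.testBit_xor, Nat.testBit_two_pow, Nat.cast_inj]
    by_cases hk : k = i
    · subst hk
      have : c k = some none := h1.2.2.2 hi
      simp [hi]
      simpa [this] using h1.1
    · have : i ≠ k := fun h => hk h.symm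
      simp [hk, this, h1]

theorem and3_ne (a b c : ℕ) : (a &&& b >>> 1 &&& c >>> 2) ≠ 0 ↔
    ∃ k, a.testBit k = true ∧ b.testBit (k+1) = true ∧ c.testBit (k+2) = true := by
  constructor
  · intro h
    obtain ⟨k, hk⟩ := Nat.exists_testBit_of_ne_zero h
    simp only [Nat.testBit_and, Nat.testBit_shiftRight, Bool.and_eq_true] at hk
    exact ⟨k, hk.1.1, by rw [add_comm]; exact hk.1.2, by rw [add_comm]; exact hk.2⟩
  · rintro ⟨k, h1, h2, h3⟩ h
    have : (a &&& b >>> 1 &&& c >>> 2).testBit k = true := by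
      simp only [Nat.testBit_and, Nat.testBit_shiftRight, Bool.and_eq_true]
      rw [add_comm 1, add_comm 2]
      exact ⟨⟨h1, h2⟩, h3⟩
    rw [h] at this; simp at this

theorem thr_iff {c s o e} (h : Rel c s o e) : thr s o e = true ↔ T c := by
  have key : thr s o e = true ↔ (s &&& (o >>> 1) &&& (e >>> 2)) ≠ 0 ∨
      (s &&& (e >>> 1) &&& (s >>> 2)) ≠ 0 ∨ (e &&& (o >>> 1) &&& (s >>> 2)) ≠ 0 := by
    unfold thr
    simp only [Bool.not_eq_true', Bool.and_eq_false_iff, beq_eq_false_iff_ne]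
    tauto
  rw [key, and3_ne, and3_ne, and3_ne]
  have h2 := h.2
  constructor
  · rintro (⟨k, h1, h2', h3⟩ | ⟨k, h1, h2', h3⟩ | ⟨k, h1, h2', h3⟩)
    · exact ⟨k, Or.inl ⟨(h2 k).1.2 h1, by exact_mod_cast (h2 (k+1)).2.1.2 h2', by exact_mod_cast (h2 (k+2)).2.2.2 h3⟩⟩
    · exact ⟨k, Or.inr (Or.inl ⟨(h2 k).1.2 h1, by exact_mod_cast (h2 (k+1)).2.2.2 h2', by exact_mod_cast (h2 (k+2)).1.2 h3⟩)⟩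
    · exact ⟨k, Or.inr (Or.inr ⟨(h2 k).2.2.2 h1, by exact_mod_cast (h2 (k+1)).2.1.2 h2', by exact_mod_cast (h2 (k+2)).1.2 h3⟩)⟩
  · rintro ⟨k, hk⟩
    have hk0 : 0 ≤ k := by
      by_contra hneg
      have := h.1 k (by omega)
      unfold TH at hk
      rw [this] at hk; simp at hk
    lift k to ℕ using hk0
    rcases hk with ⟨h1, h2', h3⟩ | ⟨h1, h2', h3⟩ | ⟨h1, h2', h3⟩
    · exact Or.inl ⟨k, (h2 k).1.1 h1, (h2 (k+1)).2.1.1 (by exact_mod_cast h2'), (h2 (k+2)).2.2.1 (by exact_mod_cast h3)⟩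
    · exact Or.inr (Or.inl ⟨k, (h2 k).1.1 h1, (h2 (k+1)).2.2.1 (by exact_mod_cast h2'), (h2 (k+2)).1.1 (by exact_mod_cast h3)⟩)
    · exact Or.inr (Or.inr ⟨k, (h2 k).2.2.1 h1, (h2 (k+1)).2.1.1 (by exact_mod_cast h2'), (h2 (k+2)).1.1 (by exact_mod_cast h3)⟩)

theorem dd_dead {c s o e} (h : Rel c s o e) (hd : dd s e = true) : Dead c := by
  intro k hk
  have hk0 : 0 ≤ k := by
    by_contra hneg
    have := h.1 k (by omega)
    rw [this] at hk; simp at hk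
  lift k to ℕ using hk0
  obtain ⟨h0, h1, h2, h3⟩ := hk
  have g1 := (h.2 (k+1)).2.2.1 (by exact_mod_cast h1)
  have g2 := (h.2 (k+2)).2.2.1 (by exact_mod_cast h2)
  have g0 : (s.testBit k || e.testBit k) = true := by
    rw [Bool.or_eq_true]
    exact h0.imp (h.2 k).1.1 (h.2 k).2.2.1
  have g3 : (s.testBit (k+3) || e.testBit (k+3)) = true := by
    rw [Bool.or_eq_true]
    exact h3.imp (fun h' => (h.2 (k+3)).1.1 (by exact_mod_cast h'))
      (fun h' => (h.2 (k+3)).2.2.1 (by exact_mod_cast h'))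
  unfold dd at hd
  rw [beq_iff_eq] at hd
  have := congrArg (fun z => z.testBit k) hd
  simp only [Nat.testBit_and, Nat.testBit_shiftRight, Nat.testBit_or, Nat.zero_testBit] at this
  rw [add_comm 1, add_comm 2, add_comm 3, g0, g1, g2, g3] at this
  simp at this

/-- Specification of the opponent's part of the solver. -/
def PSpec (n : ℕ) (P : ℕ → ℕ → ℕ → Bool) : Prop :=
  ∀ (m : ℕ) (b : Fin n → Option Letter) (s o e : ℕ), Rel (cell b) s o e → ¬ W (cell b) → ¬ T (cell b) →
    emp b = m → P s o e = true → ¬ Force (Achieves [S, O, S]) m true b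

theorem achk_sound {n : ℕ} {ord P} (hP : PSpec n P) (m : ℕ) (b : Fin n → Option Letter) (s o e : ℕ)
    (hR : Rel (cell b) s o e) (hW : ¬ W (cell b)) (hm : emp b = m)
    (h : achk ord P s o e = true) : Force (Achieves [S, O, S]) m false b := by
  cases m with
  | zero => simp [Force]
  | succ m =>
    by_cases hT : T (cell b)
    · exact force_of_T b m _ hT
    have hthr : ¬ (thr s o e = true) := fun h => hT ((thr_iff hR).1 h)
    unfold achk at h
    rw [Bool.or_eq_true] at h
    have h := h.resolve_left hthr
    rw [List.any_eq_true] at h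
    obtain ⟨⟨i, x⟩, -, h⟩ := h
    rw [Bool.and_eq_true] at h
    obtain ⟨he, h⟩ := h
    simp only at he h
    have hci := (hR.2 i).2.2.2 he
    obtain ⟨j, hj, hb⟩ := cell_some hci
    have hj' : (j : ℕ) = i := by exact_mod_cast hj
    subst hj'
    cases x
    · simp only [Bool.and_eq_true, Bool.not_eq_true'] at h
      have hR' := Rel_O hR he
      rw [← cell_update] at hR'
      refine force_of_move b m _ j O hb (hP m _ _ _ _ hR' ?_ ?_ (emp_update b j O hb m hm) h.2)
      · rw [cell_update]; exact not_win hW hT hci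
      · rw [← thr_iff hR', h.1]; simp
    · simp only [Bool.and_eq_true, Bool.not_eq_true'] at h
      have hR' := Rel_S hR he
      rw [← cell_update] at hR'
      refine force_of_move b m _ j S hb (hP m _ _ _ _ hR' ?_ ?_ (emp_update b j S hb m hm) h.2)
      · rw [cell_update]; exact not_win hW hT hci
      · rw [← thr_iff hR', h.1]; simp

theorem pchk_sound (n : ℕ) (ord) (d : ℕ) : PSpec n (pchk n ord d) := by
  induction d with
  | zero =>
    intro m b s o e hR hW hT hm h
    exact (dead_draw m b hW hm (dd_dead hR h)).2 hT
  | succ d ih =>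
    intro m b s o e hR hW hT hm h
    unfold pchk at h
    rw [Bool.or_eq_true] at h
    rcases h with h | h
    · exact (dead_draw m b hW hm (dd_dead hR h)).2 hT
    cases m with
    | zero => simp [Force]
    | succ m =>
      refine not_force b m _ hW hT ?_
      intro i x hi hW'
      have hci : cell b (i : ℕ) = some none := by rw [cell_fin, hi]
      have he := (hR.2 i).2.2.1 hci
      rw [List.all_eq_true] at h
      have h := h i (List.mem_range.2 i.2)
      rw [he] at h
      simp only [Bool.not_true, Bool.false_or, Bool.and_eq_true] at h
      cases x
      · have hR' := Rel_S hR he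
        rw [← cell_update] at hR'
        exact achk_sound ih m _ _ _ _ hR' (by rw [cell_update]; exact hW') (emp_update b i S hi m hm) h.1
      · have hR' := Rel_O hR he
        rw [← cell_update] at hR'
        exact achk_sound ih m _ _ _ _ hR' (by rw [cell_update]; exact hW') (emp_update b i O hi m hm) h.2

theorem Rel_ini (n : ℕ) : Rel (cell (ini n)) 0 0 (2 ^ n - 1) := by
  refine ⟨fun k hk => ?_, fun k => ?_⟩
  · rw [cell_ini, if_neg (by omega)]
  · rw [cell_ini, Nat.testBit_two_pow_sub_one]
    by_cases h : k < n <;> simp [h]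

theorem draw_first {n : ℕ} (ord) (d : ℕ) (h : achk ord (pchk n ord d) 0 0 (2 ^ n - 1) = true) :
    Force (Achieves [S, O, S]) n false (ini n) :=
  achk_sound (pchk_sound n ord d) n _ _ _ _ (Rel_ini n) (W_ini n) (emp_ini n) h

theorem draw_second {n : ℕ} (ord) (d : ℕ) (h : pchk n ord d 0 0 (2 ^ n - 1) = true) :
    ¬ Force (Achieves [S, O, S]) n true (ini n) :=
  pchk_sound n ord d n _ _ _ _ (Rel_ini n) (W_ini n) (T_ini n) (emp_ini n) h

/-- Move ordering for the solver. -/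
def ordO : List (ℕ × Bool) :=
  [6, 2, 9, 11, 4, 0, 7, 12, 8, 1, 10, 13, 5, 3].map (fun i => (i, false)) ++
  [13, 5, 9, 8, 7, 3, 11, 6, 4, 12, 1, 2, 0, 10].map (fun i => (i, true))

theorem draw14 : achk ordO (pchk 14 ordO 3) 0 0 (2 ^ 14 - 1) = true := by decide +kernel

theorem draw12 : achk ordO (pchk 12 ordO 2) 0 0 (2 ^ 12 - 1) = true := by decide +kernel

theorem draw10 : achk ordO (pchk 10 ordO 2) 0 0 (2 ^ 10 - 1) = true := by decide +kernel

theorem draw8 : achk ordO (pchk 8 ordO 1) 0 0 (2 ^ 8 - 1) = true := by decide +kernel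

theorem draw_even (n : ℕ) (h : n < 16) (he : Even n) :
    Force (Achieves [S, O, S]) n false (ini n) := by
  have : n = 0 ∨ n = 2 ∨ n = 4 ∨ n = 6 ∨ n = 8 ∨ n = 10 ∨ n = 12 ∨ n = 14 := by
    obtain ⟨k, rfl⟩ := he; omega
  rcases this with rfl | rfl | rfl | rfl | rfl | rfl | rfl | rfl
  · simp [Force]
  · exact draw_first ordO 0 (by decide +kernel)
  · exact draw_first ordO 0 (by decide +kernel)
  · exact draw_first ordO 0 (by decide +kernel)
  · exact draw_first ordO 1 draw8
  · exact draw_first ordO 2 draw10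
  · exact draw_first ordO 2 draw12
  · exact draw_first ordO 3 draw14

theorem draw_odd (n : ℕ) (h : n < 7) (he : Odd n) :
    ¬ Force (Achieves [S, O, S]) n true (ini n) := by
  have : n = 1 ∨ n = 3 ∨ n = 5 := by
    obtain ⟨k, rfl⟩ := he; omega
  rcases this with rfl | rfl | rfl
  · exact draw_second ordO 0 (by decide +kernel)
  · exact draw_second ordO 0 (by decide +kernel)
  · exact draw_second ordO 1 (by decide +kernel)

theorem even_not_first (n : ℕ) (h : Even n) : ¬ Force (Achieves [S, O, S]) n true (ini n) :=
  (parity n false (ini n) (W_ini n) (emp_ini n)).2 h (T_ini n) (Or.inl rfl)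

theorem odd_not_second (n : ℕ) (h : Odd n) : Force (Achieves [S, O, S]) n false (ini n) :=
  (parity n false (ini n) (W_ini n) (emp_ini n)).1 h (Or.inl rfl)

end SOSGame

/-- In the normal SOS game on the 1×n board: the first player can force a win
iff `n ≥ 7` and `n` is odd; the second player can force a win iff `n ≥ 16` and
`n` is even; in all other cases the game is a draw. -/
theorem sos_game_solution (n : ℕ) :
    (FirstWins [S, O, S] n ↔ 7 ≤ n ∧ Odd n) ∧
    (SecondWins [S, O, S] n ↔ 16 ≤ n ∧ Even n) ∧
    (¬ (7 ≤ n ∧ Odd n) → ¬ (16 ≤ n ∧ Even n) → IsDraw [S, O, S] n) := by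
  have A : ¬ (7 ≤ n ∧ Odd n) → ¬ Force (Achieves [S, O, S]) n true (SOSGame.ini n) := by
    intro h
    rcases Nat.even_or_odd n with he | ho
    · exact SOSGame.even_not_first n he
    · exact SOSGame.draw_odd n (by by_contra h'; exact h ⟨by omega, ho⟩) ho
  have B : ¬ (16 ≤ n ∧ Even n) → Force (Achieves [S, O, S]) n false (SOSGame.ini n) := by
    intro h
    rcases Nat.even_or_odd n with he | ho
    · exact SOSGame.draw_even n (by by_contra h'; exact h ⟨by omega, he⟩) he
    · exact SOSGame.odd_not_second n ho
  refine ⟨⟨fun h => ?_, fun h => SOSGame.first_wins n h.1 h.2⟩,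
    ⟨fun h => ?_, fun h => SOSGame.second_wins n h.1 h.2⟩, fun h1 h2 => ⟨B h2, A h1⟩⟩
  · by_contra h'; exact A h' h
  · by_contra h'; exact h (B h')
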